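/- Fix n ∈ ℕ₊. Let ε > 0, let r, R, d ∈ ℕ with n ≤ r < R, and let ℳ = (M₁, …, Mₙ) be a ∗-closed tuple of d×d complex matrices. Let (A₁, B₁) be an (R, ε)-pair for ℳ, and let W = ⨁_{j=1}^k B_ℳ(wⱼ, Rⱼ) be an R-multi-ballspace for ℳ contained in B₁, such that moreover the ballspaces B_ℳ(wⱼ, Rⱼ + r) are regular for all j. Let B₂ be the orthogonal complement of W in B₁. Then there exists a subspace A₂ ⊆ A₁ ∩ B₂ such that (A₂, B₂) is an (r, ε + (n/R)·2^r)-pair for ℳ. -/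

import Mathlib

open MvPolynomial Module Matrix

variable {V : Type*} [AddCommGroup V] [Module ℂ V]

/-- For a tuple `M : Fin n → End(V)` and a word `α : [q] → [n]`, the composite
`ℳ_α = M_{α 0} ∘ ⋯ ∘ M_{α (q-1)}` (the empty word gives the identity). -/
noncomputable def mword {n : ℕ} (M : Fin n → Module.End ℂ V) {q : ℕ}
    (α : Fin q → Fin n) : Module.End ℂ V :=
  (List.ofFn fun j => M (α j)).prod

/-- The `R`-ballspace `B_ℳ(w, R)`: the span of all `ℳ_α(w)` over words `α` of length `≤ R`. -/
noncomputable def ballSpace {n : ℕ} (M : Fin n → Module.End ℂ V) (w : V) (R : ℕ) :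
    Submodule ℂ V :=
  Submodule.span ℂ {v | ∃ (q : ℕ) (_ : q ≤ R) (α : Fin q → Fin n), v = mword M α w}

/-- `F^𝔞_i`: the subspace of `ℂ[X₁,…,Xₙ]/𝔞` of elements representable as `f + 𝔞` with
`deg f ≤ i`. -/
noncomputable def Fdeg (n : ℕ) (𝔞 : Ideal (MvPolynomial (Fin n) ℂ)) (i : ℕ) :
    Submodule ℂ (MvPolynomial (Fin n) ℂ ⧸ 𝔞) :=
  (restrictTotalDegree (Fin n) ℂ i).map (Ideal.Quotient.mkₐ ℂ 𝔞).toLinearMap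

/-- `μ^𝔞ᵢ`: multiplication by `Xᵢ + 𝔞` on `ℂ[X₁,…,Xₙ]/𝔞`. -/
noncomputable def muX (n : ℕ) (𝔞 : Ideal (MvPolynomial (Fin n) ℂ)) (i : Fin n) :
    Module.End ℂ (MvPolynomial (Fin n) ℂ ⧸ 𝔞) :=
  LinearMap.mulLeft ℂ (Ideal.Quotient.mk 𝔞 (X i))

/-- The ballspace `B_ℳ(w, R)` is regular. -/
noncomputable def IsRegularBall {n : ℕ} (M : Fin n → Module.End ℂ V) (w : V) (R : ℕ) : Prop :=
  ∃ (𝔞 : Ideal (MvPolynomial (Fin n) ℂ))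
    (φ : (ballSpace M w R) ≃ₗ[ℂ] (Fdeg n 𝔞 R)),
    (∀ (j : ℕ), j + 1 = R → ∀ (i : Fin n) (v : V),
      v ∈ ballSpace M w j → ∀ (hv' : v ∈ ballSpace M w R) (hvi : M i v ∈ ballSpace M w R),
        ((φ ⟨M i v, hvi⟩ : Fdeg n 𝔞 R) : MvPolynomial (Fin n) ℂ ⧸ 𝔞) =
          muX n 𝔞 i ((φ ⟨v, hv'⟩ : Fdeg n 𝔞 R) : MvPolynomial (Fin n) ℂ ⧸ 𝔞)) ∧
    (∀ x : MvPolynomial (Fin n) ℂ ⧸ 𝔞, x ∈ Fdeg n 𝔞 R →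
      x ∈ Ideal.map (Ideal.Quotient.mk 𝔞) 𝔞.radical → x = 0)

/-- `(A, B)` is an `(r, ε)`-pair for `ℳ` (in dimension `d`): `A ⊆ B`, `dim(B/A) ≤ ε·d`,
and every word of length `≤ r` in `ℳ` maps `A` into `B`. -/
noncomputable def IsPair {n : ℕ} (M : Fin n → Module.End ℂ V) (r : ℕ) (ε : ℝ) (d : ℕ)
    (A B : Submodule ℂ V) : Prop :=
  A ≤ B ∧ ((finrank ℂ B : ℝ) - finrank ℂ A ≤ ε * d) ∧
    ∀ (q : ℕ), q ≤ r → ∀ (α : Fin q → Fin n), ∀ v ∈ A, mword M α v ∈ B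

section hilb
variable {n : ℕ} {A : Type*} [AddCommGroup A] [Module ℂ A]

def stdM (e : (Fin n →₀ ℕ) → A) : Set (Fin n →₀ ℕ) :=
  {m | e m ∉ Submodule.span ℂ (e '' {b | MonomialOrder.degLex.toSyn b < MonomialOrder.degLex.toSyn m})}

lemma degLex_degree_le {a b : Fin n →₀ ℕ}
    (h : MonomialOrder.degLex.toSyn a ≤ MonomialOrder.degLex.toSyn b) : a.degree ≤ b.degree := by
  exact Finsupp.DegLex.monotone_degree h

lemma stdM_down (e : (Fin n →₀ ℕ) → A)
    (hmul : ∀ m, ∃ T : A →ₗ[ℂ] A, ∀ b, e (m + b) = T (e b))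
    (a b : Fin n →₀ ℕ) (h : a + b ∈ stdM e) : b ∈ stdM e := by
  intro hb
  apply h
  obtain ⟨T, hT⟩ := hmul a
  rw [hT b]
  have := Submodule.mem_map_of_mem (f := T) hb
  rw [Submodule.map_span] at this
  refine Submodule.span_mono ?_ this
  rintro _ ⟨_, ⟨c, hc, rfl⟩, rfl⟩
  refine ⟨a + c, ?_, hT c⟩
  simp only [Set.mem_ofPred_eq, map_add] at hc ⊢
  exact add_lt_add_right hc _

lemma stdM_span (e : (Fin n →₀ ℕ) → A) (i : ℕ) :
    Submodule.span ℂ (e '' {m | m ∈ stdM e ∧ m.degree ≤ i}) =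
      Submodule.span ℂ (e '' {m | m.degree ≤ i}) := by
  apply le_antisymm
  · exact Submodule.span_mono (Set.image_mono fun m hm => hm.2)
  · rw [Submodule.span_le]
    rintro _ ⟨m, hm, rfl⟩
    have key : ∀ s : (MonomialOrder.degLex (σ := Fin n)).syn, ∀ m : Fin n →₀ ℕ,
        MonomialOrder.degLex.toSyn m = s → m.degree ≤ i →
        e m ∈ Submodule.span ℂ (e '' {m | m ∈ stdM e ∧ m.degree ≤ i}) := by
      intro s
      induction s using WellFoundedLT.induction with
      | ind s ih =>
        rintro m rfl hmi
        by_cases hS : m ∈ stdM e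
        · exact Submodule.subset_span ⟨m, ⟨hS, hmi⟩, rfl⟩
        · have hS' := not_not.mp hS
          refine Submodule.span_le.mpr ?_ hS'
          rintro _ ⟨b, hb, rfl⟩
          exact ih _ hb b rfl ((degLex_degree_le (le_of_lt hb)).trans hmi)
    exact key _ m rfl hm

lemma stdM_indep (e : (Fin n →₀ ℕ) → A) : LinearIndepOn ℂ e (stdM e) := by
  rw [linearIndepOn_iff]
  intro l hl h0
  by_contra hne
  have hs : l.support.Nonempty := Finsupp.support_nonempty_iff.mpr hne
  obtain ⟨m, hm, hmax⟩ := Finset.exists_max_image l.support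
    (fun a => MonomialOrder.degLex.toSyn a) hs
  have hmS : m ∈ stdM e := hl hm
  apply hmS
  rw [Finsupp.linearCombination_apply, Finsupp.sum, ← Finset.add_sum_erase _ _ hm] at h0
  have hc : l m ≠ 0 := Finsupp.mem_support_iff.mp hm
  have h1 : l m • e m ∈ Submodule.span ℂ
      (e '' {b | MonomialOrder.degLex.toSyn b < MonomialOrder.degLex.toSyn m}) := by
    rw [eq_neg_of_add_eq_zero_left h0]
    refine Submodule.neg_mem _ (Submodule.sum_mem _ fun b hb => Submodule.smul_mem _ _ ?_)
    refine Submodule.subset_span ⟨b, ?_, rfl⟩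
    rw [Finset.mem_erase] at hb
    refine lt_of_le_of_ne (hmax b hb.2) fun h => hb.1 (MonomialOrder.degLex.toSyn.injective h)
  exact (Submodule.smul_mem_iff _ hc).mp h1

lemma finite_deg (i : ℕ) : {m : Fin n →₀ ℕ | m.degree ≤ i}.Finite := 
  Finsupp.finite_of_degree_le i

noncomputable def stdF (e : (Fin n →₀ ℕ) → A) (i : ℕ) : Finset (Fin n →₀ ℕ) :=
  ((finite_deg i).subset (t := {m | m ∈ stdM e ∧ m.degree ≤ i}) fun _ h => h.2).toFinset

lemma mem_stdF (e : (Fin n →₀ ℕ) → A) (i : ℕ) (m) :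
    m ∈ stdF e i ↔ m ∈ stdM e ∧ m.degree ≤ i := by
  simp [stdF]

lemma finrank_stdF (e : (Fin n →₀ ℕ) → A) (i : ℕ) :
    finrank ℂ (Submodule.span ℂ (e '' {m | m.degree ≤ i})) = (stdF e i).card := by
  rw [← stdM_span]
  have hcoe : {m | m ∈ stdM e ∧ m.degree ≤ i} = ((stdF e i : Finset _) : Set (Fin n →₀ ℕ)) := by
    ext m; simp [mem_stdF]
  rw [hcoe]
  have hli : LinearIndepOn ℂ e ((stdF e i : Finset _) : Set (Fin n →₀ ℕ)) :=
    (stdM_indep e).mono (by rw [← hcoe]; exact fun m hm => hm.1)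
  have := finrank_span_eq_card (R := ℂ) hli.linearIndependent
  rw [Set.image_eq_range]
  rw [this]; simp

open Classical in
lemma stdF_step (e : (Fin n →₀ ℕ) → A)
    (hmul : ∀ m, ∃ T : A →ₗ[ℂ] A, ∀ b, e (m + b) = T (e b)) (i : ℕ) :
    ((stdF e (i+1)).card : ℝ) ≤ (1 + n / (i + 1 : ℝ)) * (stdF e i).card := by
  set T := (stdF e (i+1)).filter (fun m => m.degree = i + 1) with hT
  have hcard : (stdF e (i+1)).card = (stdF e i).card + T.card := by
    rw [← Finset.card_filter_add_card_filter_not (s := stdF e (i+1)) (fun m => m.degree = i+1), add_comm]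
    congr 2
    ext m
    simp only [Finset.mem_filter, mem_stdF]
    constructor
    · rintro ⟨⟨h1, h2⟩, h3⟩; exact ⟨h1, by omega⟩
    · rintro ⟨h1, h2⟩; exact ⟨⟨h1, by omega⟩, by omega⟩
  have hdc : T.card * (i+1) ≤ (stdF e i).card * n := by
    apply Finset.card_mul_le_card_mul (fun m m' => ∃ j k, m = Finsupp.single j k + m')
    · intro m hm
      simp only [hT, Finset.mem_filter, mem_stdF] at hm
      have h1 : (Finset.univ.sigma (fun j : Fin n => Finset.range (m j))).card = i + 1 := by
        rw [Finset.card_sigma, ← hm.2, Finsupp.degree_eq_sum]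
        simp
      rw [← h1]
      have hadd : ∀ (j : Fin n) (k : ℕ), k < m j →
          m = Finsupp.single j (k+1) + (m - Finsupp.single j (k+1)) := by
        intro j k hk
        rw [add_tsub_cancel_of_le]
        rw [Finsupp.single_le_iff]; omega
      apply Finset.card_le_card_of_injOn (fun p => m - Finsupp.single p.1 (p.2+1))
      · rintro ⟨j, k⟩ hp
        simp only [Finset.coe_sigma, Set.mem_sigma_iff, Finset.coe_univ, Set.mem_univ,
          Finset.coe_range, Set.mem_Iio, true_and] at hp
        simp only [Finset.coe_bipartiteAbove, Set.mem_ofPred_eq, mem_stdF]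
        have h2 := hadd j k hp
        refine ⟨⟨?_, ?_⟩, j, k+1, h2⟩
        · apply stdM_down e hmul (Finsupp.single j (k+1))
          rw [← h2]; exact hm.1.1
        · have h3 := congrArg Finsupp.degree h2
          rw [map_add, Finsupp.degree_single] at h3
          omega
      · rintro ⟨j, k⟩ hp ⟨j', k'⟩ hp' heq
        simp only [Finset.coe_sigma, Set.mem_sigma_iff, Finset.coe_univ, Set.mem_univ,
          Finset.coe_range, Set.mem_Iio, true_and] at hp hp'
        have h4 := DFunLike.congr_fun heq j
        simp only [Finsupp.tsub_apply, Finsupp.single_eq_same] at h4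
        by_cases hj : j = j'
        · subst hj
          simp only [Finsupp.single_eq_same] at h4
          have : k = k' := by omega
          rw [this]
        · rw [Finsupp.single_eq_of_ne hj] at h4
          omega
    · intro m' hm'
      calc _ ≤ (Finset.univ.image (fun j : Fin n => Finsupp.single j (i + 1 - m'.degree) + m')).card := by
            apply Finset.card_le_card
            intro m hm
            simp only [Finset.mem_bipartiteBelow, hT, Finset.mem_filter] at hm
            obtain ⟨⟨_, hd⟩, j, k, rfl⟩ := hm
            rw [map_add, Finsupp.degree_single] at hd
            simp only [Finset.mem_image, Finset.mem_univ, true_and]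
            refine ⟨j, ?_⟩
            congr 2; omega
        _ ≤ n := by
            refine Finset.card_image_le.trans ?_
            simp
  have hdc' : (T.card : ℝ) * (i+1) ≤ (stdF e i).card * n := by exact_mod_cast hdc
  rw [hcard]
  push_cast
  have hpos : (0:ℝ) < i + 1 := by positivity
  have : (T.card : ℝ) ≤ (stdF e i).card * n / (i+1) := by rwa [le_div_iff₀ hpos]
  have h5 : (1 + n / (i + 1 : ℝ)) * (stdF e i).card = (stdF e i).card + (stdF e i).card * n / (i+1) := by ring
  rw [h5]; linarith

lemma stdF_bound (e : (Fin n →₀ ℕ) → A)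
    (hmul : ∀ m, ∃ T : A →ₗ[ℂ] A, ∀ b, e (m + b) = T (e b)) (N r R : ℕ) (hR : n ≤ R) (hR0 : 0 < R)
    (hN : R ≤ N) :
    ((stdF e (N+r)).card : ℝ) ≤ (1 + (n / R : ℝ) * (2^r - 1)) * (stdF e N).card := by
  have hR' : (0:ℝ) < R := by exact_mod_cast hR0
  have hx1 : (n / R : ℝ) ≤ 1 := by
    rw [div_le_one hR']; exact_mod_cast hR
  have hx0 : (0:ℝ) ≤ n / R := by positivity
  induction r with
  | zero => simp
  | succ r ih =>
    have h1 := stdF_step e hmul (N + r)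
    have h2 : (n / ((N + r : ℕ) + 1 : ℝ)) ≤ n / R := by
      apply div_le_div_of_nonneg_left (by positivity) hR'
      have : R ≤ N + r + 1 := by omega
      exact_mod_cast this
    have hc : (0:ℝ) ≤ (stdF e N).card := by positivity
    have h2r : (1:ℝ) ≤ 2^r := one_le_pow₀ (by norm_num)
    calc ((stdF e (N+(r+1))).card : ℝ) ≤ (1 + n / ((N + r : ℕ) + 1 : ℝ)) * (stdF e (N+r)).card := h1
      _ ≤ (1 + n / R) * ((1 + (n / R : ℝ) * (2^r - 1)) * (stdF e N).card) := by
          gcongr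
      _ = ((1 + n / R) * (1 + (n / R : ℝ) * (2^r - 1))) * (stdF e N).card := by ring
      _ ≤ _ := by
          gcongr
          rw [pow_succ]
          nlinarith [mul_nonneg (mul_nonneg hx0 (sub_nonneg.mpr hx1)) (sub_nonneg.mpr h2r)]

end hilb

lemma mword_succ {n : ℕ} (M : Fin n → Module.End ℂ V) {q : ℕ} (α : Fin (q+1) → Fin n) :
    mword M α = M (α 0) * mword M (fun j => α j.succ) := by
  simp [mword, List.ofFn_succ]

lemma ball_mono {n : ℕ} (M : Fin n → Module.End ℂ V) (w : V) {i j : ℕ} (h : i ≤ j) :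
    ballSpace M w i ≤ ballSpace M w j := by
  apply Submodule.span_mono
  rintro _ ⟨q, hq, α, rfl⟩
  exact ⟨q, hq.trans h, α, rfl⟩

lemma ball_step {n : ℕ} (M : Fin n → Module.End ℂ V) (w : V) {i : ℕ} (k : Fin n) {v : V}
    (hv : v ∈ ballSpace M w i) : M k v ∈ ballSpace M w (i+1) := by
  have := Submodule.mem_map_of_mem (f := M k) hv
  rw [ballSpace, Submodule.map_span] at this
  refine Submodule.span_mono ?_ this
  rintro _ ⟨_, ⟨q, hq, α, rfl⟩, rfl⟩
  refine ⟨q+1, by omega, Fin.cons k α, ?_⟩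
  rw [mword_succ]
  simp

lemma ball_growth {n : ℕ} (M : Fin n → Module.End ℂ V) (w : V) (N r R : ℕ)
    (hR : n ≤ R) (hR0 : 0 < R) (hN : R ≤ N) (hreg : IsRegularBall M w (N + r)) :
    (finrank ℂ (ballSpace M w (N+r)) : ℝ) ≤
      (1 + (n / R : ℝ) * (2^r - 1)) * finrank ℂ (ballSpace M w N) := by
  obtain ⟨Q, hQ⟩ : ∃ Q, Q = N + r := ⟨_, rfl⟩
  rw [← hQ] at hreg ⊢
  obtain ⟨𝔞, φ, hφ, -⟩ := hreg
  set ψ : ballSpace M w Q →ₗ[ℂ] (MvPolynomial (Fin n) ℂ ⧸ 𝔞) :=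
    (Fdeg n 𝔞 Q).subtype ∘ₗ φ.toLinearMap with hψ
  have hinj : Function.Injective ψ := by
    rw [hψ, LinearMap.coe_comp]
    exact (Fdeg n 𝔞 Q).injective_subtype.comp φ.injective
  have hw : w ∈ ballSpace M w Q :=
    Submodule.subset_span ⟨0, Nat.zero_le _, Fin.elim0, by simp [mword]⟩
  have hmem : ∀ (q : ℕ) (α : Fin q → Fin n), mword M α w ∈ ballSpace M w q :=
    fun q α => Submodule.subset_span ⟨q, le_rfl, α, rfl⟩
  set g := ψ ⟨w, hw⟩ with hg
  set e : (Fin n →₀ ℕ) → (MvPolynomial (Fin n) ℂ ⧸ 𝔞) :=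
    fun m => Ideal.Quotient.mk 𝔞 (monomial m 1) * g with he
  have hmul : ∀ m, ∃ T : (MvPolynomial (Fin n) ℂ ⧸ 𝔞) →ₗ[ℂ] (MvPolynomial (Fin n) ℂ ⧸ 𝔞),
      ∀ b, e (m + b) = T (e b) := by
    intro m
    refine ⟨LinearMap.mulLeft ℂ (Ideal.Quotient.mk 𝔞 (monomial m 1)), fun b => ?_⟩
    simp only [he, LinearMap.mulLeft_apply]
    rw [← mul_assoc, ← map_mul, monomial_mul, one_mul]
  have hword : ∀ (q : ℕ) (hq : q ≤ Q) (α : Fin q → Fin n),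
      ψ ⟨mword M α w, ball_mono M w hq (hmem q α)⟩ = e (∑ j, Finsupp.single (α j) 1) := by
    intro q
    induction q with
    | zero =>
      intro hq α
      simp only [he, mword, hg]
      simp
    | succ q ih =>
      intro hq α
      have h1 := ih (by omega) (fun j => α j.succ)
      have h2 := hφ (Q - 1) (by omega) (α 0) (mword M (fun j => α j.succ) w)
        (ball_mono M w (by omega) (hmem q _)) (ball_mono M w (by omega) (hmem q _))
        (ball_mono M w hq (ball_step M w _ (hmem q _)))
      have h3 : ψ ⟨mword M α w, ball_mono M w hq (hmem _ α)⟩ =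
          ψ ⟨M (α 0) (mword M (fun j => α j.succ) w),
            ball_mono M w hq (ball_step M w _ (hmem q _))⟩ := by
        congr 2
        rw [mword_succ]; rfl
      rw [h3]
      refine h2.trans ?_
      change muX n 𝔞 (α 0) (ψ _) = _
      rw [h1, Fin.sum_univ_succ]
      simp only [he, muX, LinearMap.mulLeft_apply]
      rw [← mul_assoc, ← map_mul, X, monomial_mul, one_mul]
  have hsum : ∀ m : Fin n →₀ ℕ, ∃ α : Fin m.degree → Fin n,
      ∑ j, Finsupp.single (α j) 1 = m := by
    have : ∀ q, ∀ m : Fin n →₀ ℕ, m.degree = q → ∃ α : Fin q → Fin n,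
      ∑ j, Finsupp.single (α j) 1 = m := by
      intro q
      induction q with
      | zero =>
        intro m hm
        rw [Finsupp.degree_eq_zero_iff] at hm
        exact ⟨Fin.elim0, by simp [hm]⟩
      | succ q ih =>
        intro m hm
        have hne : m ≠ 0 := by rintro rfl; simp at hm
        obtain ⟨j, hj⟩ := Finsupp.ne_iff.mp hne
        simp only [Finsupp.coe_zero, Pi.zero_apply] at hj
        have hle : Finsupp.single j 1 ≤ m := by
          rw [Finsupp.single_le_iff]; omega
        have hadd := add_tsub_cancel_of_le hle
        have hd := congrArg Finsupp.degree hadd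
        rw [map_add, Finsupp.degree_single] at hd
        obtain ⟨α, hα⟩ := ih (m - Finsupp.single j 1) (by omega)
        refine ⟨Fin.cons j α, ?_⟩
        rw [Fin.sum_univ_succ]
        simp [hα, hadd]
    exact fun m => this _ m rfl
  have hdim : ∀ i ≤ Q, finrank ℂ (ballSpace M w i) = (stdF e i).card := by
    intro i hi
    rw [← finrank_stdF]
    have hle := ball_mono M w hi
    rw [← (Submodule.comapSubtypeEquivOfLe hle).finrank_eq,
      (Submodule.equivMapOfInjective ψ hinj _).finrank_eq]
    suffices hs : Submodule.map ψ (Submodule.comap (ballSpace M w Q).subtype (ballSpace M w i)) =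
        Submodule.span ℂ (e '' {m | Finsupp.degree m ≤ i}) by rw [hs]
    have hcomap : Submodule.comap (ballSpace M w Q).subtype (ballSpace M w i) =
        Submodule.span ℂ {v : ballSpace M w Q | ∃ (q : ℕ) (_ : q ≤ i) (α : Fin q → Fin n),
          (v : V) = mword M α w} := by
      apply Submodule.map_injective_of_injective (ballSpace M w Q).injective_subtype
      rw [Submodule.map_comap_subtype, inf_eq_right.mpr hle, Submodule.map_span]
      rw [ballSpace]
      congr 1
      ext v
      constructor
      · rintro ⟨q, hq, α, rfl⟩
        exact ⟨⟨_, ball_mono M w (hq.trans hi) (hmem q α)⟩, ⟨q, hq, α, rfl⟩, rfl⟩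
      · rintro ⟨v, ⟨q, hq, α, h⟩, rfl⟩
        exact ⟨q, hq, α, h⟩
    rw [hcomap, Submodule.map_span]
    congr 1
    ext x
    constructor
    · rintro ⟨⟨v, hv⟩, ⟨q, hq, α, h⟩, rfl⟩
      simp only at h
      subst h
      rw [hword q (hq.trans hi) α]
      refine ⟨_, ?_, rfl⟩
      simp only [Set.mem_ofPred_eq, map_sum, Finsupp.degree_single]
      simpa using hq
    · rintro ⟨m, hm, rfl⟩
      obtain ⟨α, hα⟩ := hsum m
      have := hword m.degree (le_trans hm hi) α
      rw [hα] at this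
      exact ⟨_, ⟨m.degree, hm, α, rfl⟩, this⟩
  rw [hdim N (by omega), hdim Q le_rfl]
  rw [hQ]
  exact stdF_bound e hmul N r R hR hR0 hN

lemma finrank_iSup_le' [FiniteDimensional ℂ V] {k : ℕ} (U : Fin k → Submodule ℂ V) :
    finrank ℂ (⨆ j, U j : Submodule ℂ V) ≤ ∑ j, finrank ℂ (U j) := by
  classical
  rw [← Finset.sup_univ_eq_iSup]
  induction (Finset.univ : Finset (Fin k)) using Finset.induction_on with
  | empty => simp
  | insert a s ha ih =>
    rw [Finset.sup_insert, Finset.sum_insert ha]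
    have := Submodule.finrank_add_le_finrank_add_finrank (U a) (s.sup fun j => U j)
    omega

lemma finrank_iSup_eq' [FiniteDimensional ℂ V] {k : ℕ} (U : Fin k → Submodule ℂ V)
    (hU : iSupIndep U) :
    finrank ℂ (⨆ j, U j : Submodule ℂ V) = ∑ j, finrank ℂ (U j) := by
  classical
  rw [← Finset.sup_univ_eq_iSup]
  induction (Finset.univ : Finset (Fin k)) using Finset.induction_on with
  | empty => simp
  | insert a s ha ih =>
    rw [Finset.sup_insert, Finset.sum_insert ha]
    have hd : Disjoint (U a) (s.sup fun j => U j) := by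
      refine (hU a).mono_right (Finset.sup_le fun b hb => ?_)
      exact le_iSup₂_of_le b (fun h => ha (h ▸ hb)) le_rfl
    have := Submodule.finrank_sup_add_finrank_inf_eq (U a) (s.sup fun j => U j)
    rw [hd.eq_bot, finrank_bot] at this
    omega

lemma orth_step {n d : ℕ} (M : Fin n → Matrix (Fin d) (Fin d) ℂ)
    (hstar : ∀ i, ∃ j, (M i)ᴴ = M j) (w v : EuclideanSpace ℂ (Fin d)) (i : ℕ) (k : Fin n)
    (hv : v ∈ (ballSpace (fun i => Matrix.toEuclideanLin (M i)) w (i+1))ᗮ) :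
    Matrix.toEuclideanLin (M k) v ∈ (ballSpace (fun i => Matrix.toEuclideanLin (M i)) w i)ᗮ := by
  rw [Submodule.mem_orthogonal] at hv ⊢
  intro u hu
  obtain ⟨j, hj⟩ := hstar k
  rw [← LinearMap.adjoint_inner_left, ← Matrix.toEuclideanLin_conjTranspose_eq_adjoint, hj]
  exact hv _ (ball_step (fun i => Matrix.toEuclideanLin (M i)) w j hu)

lemma orth_word {n d : ℕ} (M : Fin n → Matrix (Fin d) (Fin d) ℂ)
    (hstar : ∀ i, ∃ j, (M i)ᴴ = M j) (w v : EuclideanSpace ℂ (Fin d)) (q : ℕ) :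
    ∀ (i : ℕ) (α : Fin q → Fin n),
    v ∈ (ballSpace (fun i => Matrix.toEuclideanLin (M i)) w (i+q))ᗮ →
    mword (fun i => Matrix.toEuclideanLin (M i)) α v ∈
      (ballSpace (fun i => Matrix.toEuclideanLin (M i)) w i)ᗮ := by
  induction q with
  | zero => intro i α hv; simpa [mword] using hv
  | succ q ih =>
    intro i α hv
    rw [mword_succ]
    apply orth_step M hstar
    apply ih
    rwa [show i + 1 + q = i + (q + 1) by omega]

/-- **Lemma.** Fix `n ∈ ℕ₊`. Let `ε > 0`, `n ≤ r < R`, and `ℳ` a `∗`-closed tuple of `d×d`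
complex matrices. Let `(A₁, B₁)` be an `(R, ε)`-pair, and `W = ⨁ⱼ B_ℳ(wⱼ, Rⱼ)` an
`R`-multi-ballspace for `ℳ` contained in `B₁` whose ballspaces `B_ℳ(wⱼ, Rⱼ + r)` are also
regular. Let `B₂` be the orthogonal complement of `W` in `B₁`. Then some `A₂ ⊆ A₁ ∩ B₂`
makes `(A₂, B₂)` an `(r, ε + (n/R)·2^r)`-pair. -/
theorem pair_reduction
    (n : ℕ) (hn : 0 < n) (ε : ℝ) (hε : 0 < ε) (r R d : ℕ) (hnr : n ≤ r) (hrR : r < R)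
    (M : Fin n → Matrix (Fin d) (Fin d) ℂ)
    (hstar : ∀ i, ∃ j, (M i)ᴴ = M j)
    (A₁ B₁ : Submodule ℂ (EuclideanSpace ℂ (Fin d)))
    (hpair : IsPair (fun i => Matrix.toEuclideanLin (M i)) R ε d A₁ B₁)
    (k : ℕ) (w : Fin k → EuclideanSpace ℂ (Fin d)) (Rad : Fin k → ℕ)
    (hRad : ∀ j, R ≤ Rad j)
    (hreg : ∀ j, IsRegularBall (fun i => Matrix.toEuclideanLin (M i)) (w j) (Rad j))
    (hindep : iSupIndep fun j => ballSpace (fun i => Matrix.toEuclideanLin (M i)) (w j) (Rad j))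
    (hWB : (⨆ j, ballSpace (fun i => Matrix.toEuclideanLin (M i)) (w j) (Rad j)) ≤ B₁)
    (hreg' : ∀ j, IsRegularBall (fun i => Matrix.toEuclideanLin (M i)) (w j) (Rad j + r)) :
    ∃ A₂ : Submodule ℂ (EuclideanSpace ℂ (Fin d)),
      A₂ ≤ A₁ ⊓ (B₁ ⊓ (⨆ j, ballSpace (fun i => Matrix.toEuclideanLin (M i)) (w j) (Rad j))ᗮ) ∧
      IsPair (fun i => Matrix.toEuclideanLin (M i)) r (ε + ((n : ℝ) / R) * 2 ^ r) d A₂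
        (B₁ ⊓ (⨆ j, ballSpace (fun i => Matrix.toEuclideanLin (M i)) (w j) (Rad j))ᗮ) := by
  classical
  set E := fun i => Matrix.toEuclideanLin (M i) with hE
  set W : Submodule ℂ (EuclideanSpace ℂ (Fin d)) := ⨆ j, ballSpace E (w j) (Rad j) with hW
  set W' : Submodule ℂ (EuclideanSpace ℂ (Fin d)) := ⨆ j, ballSpace E (w j) (Rad j + r) with hW'
  obtain ⟨hAB, hdim, hmap⟩ := hpair
  have hWW' : W ≤ W' := iSup_mono fun j => ball_mono E (w j) (Nat.le_add_right _ _)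
  have hsub : A₁ ⊓ W'ᗮ ≤ A₁ ⊓ (B₁ ⊓ Wᗮ) :=
    le_inf inf_le_left (inf_le_inf hAB (Submodule.orthogonal_le hWW'))
  refine ⟨A₁ ⊓ W'ᗮ, hsub, hsub.trans inf_le_right, ?_, ?_⟩
  · have h1 := Submodule.finrank_add_inf_finrank_orthogonal hWB
    have h2 := Submodule.finrank_sup_add_finrank_inf_eq A₁ W'ᗮ
    have h3 := W'.finrank_add_finrank_orthogonal
    have h4 : finrank ℂ (A₁ ⊔ W'ᗮ : Submodule ℂ (EuclideanSpace ℂ (Fin d))) ≤ _ :=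
      Submodule.finrank_le _
    have h5 : finrank ℂ W' ≤ ∑ j, finrank ℂ (ballSpace E (w j) (Rad j + r)) := finrank_iSup_le' _
    have h6 : finrank ℂ W = ∑ j, finrank ℂ (ballSpace E (w j) (Rad j)) := finrank_iSup_eq' _ hindep
    have h7 : finrank ℂ W ≤ d := by
      have := Submodule.finrank_le W
      simpa using this
    have h8 : (finrank ℂ W' : ℝ) ≤ (1 + (n / R : ℝ) * (2^r - 1)) * finrank ℂ W := by
      calc (finrank ℂ W' : ℝ) ≤ ∑ j, (finrank ℂ (ballSpace E (w j) (Rad j + r)) : ℝ) := by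
            exact_mod_cast h5
        _ ≤ ∑ j, (1 + (n / R : ℝ) * (2^r - 1)) * (finrank ℂ (ballSpace E (w j) (Rad j)) : ℝ) :=
            Finset.sum_le_sum fun j _ => ball_growth E (w j) (Rad j) r R (by omega) (by omega)
              (hRad j) (hreg' j)
        _ = _ := by rw [h6, ← Finset.mul_sum]; push_cast; rfl
    have h9 : finrank ℂ A₁ ≤ finrank ℂ (A₁ ⊓ W'ᗮ : Submodule ℂ (EuclideanSpace ℂ (Fin d)))
        + finrank ℂ W' := by omega
    have h9' : (finrank ℂ A₁ : ℝ) ≤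
        finrank ℂ (A₁ ⊓ W'ᗮ : Submodule ℂ (EuclideanSpace ℂ (Fin d))) + finrank ℂ W' := by
      exact_mod_cast h9
    have h1' : (finrank ℂ W : ℝ) +
        finrank ℂ (B₁ ⊓ Wᗮ : Submodule ℂ (EuclideanSpace ℂ (Fin d))) = finrank ℂ B₁ := by
      rw [inf_comm] at h1
      exact_mod_cast h1
    have h7' : (finrank ℂ W : ℝ) ≤ d := by exact_mod_cast h7
    have hx0 : (0:ℝ) ≤ n / R := by positivity
    have h10 : (n / R : ℝ) * (2^r - 1) * finrank ℂ W ≤ (n / R : ℝ) * 2^r * d := by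
      have : (1:ℝ) ≤ 2^r := one_le_pow₀ (by norm_num)
      have h0 : (0:ℝ) ≤ 2^r - 1 := by linarith
      gcongr
      linarith
    linarith
  · intro q hq α v hv
    refine ⟨hmap q (by omega) α v hv.1, ?_⟩
    rw [hW, ← Submodule.iInf_orthogonal]
    rw [SetLike.mem_coe, Submodule.mem_iInf]
    intro j
    apply orth_word M hstar
    refine Submodule.orthogonal_le ?_ hv.2
    exact (ball_mono E (w j) (by omega)).trans (le_iSup (fun j => ballSpace E (w j) (Rad j + r)) j)
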